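/- Let B ⊆ [0,1) be a compact set with B \ D nonempty, where D is the set of dyadic rationals. Then liminf_{n→∞} OFF_n(B) ≤ dim_H(B). -/

import Mathlib

open MeasureTheory Set Filter
open scoped ENNReal

/-- The set of dyadic rationals. -/
def dyadicRationals : Set ℝ :=
  {x | ∃ k : ℤ, ∃ n : ℕ, x = (k : ℝ) / 2 ^ n}

open Classical in
/-- `numOff B n x` is `1` if both closed halves of the `n`-cell containing `x`
meet `B \ D` (where `D` is the set of dyadic rationals), and `0` otherwise. -/
noncomputable def numOff (B : Set ℝ) (n : ℕ) (x : ℝ) : ℝ :=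
  if (Icc ((⌊2 ^ n * x⌋ : ℝ) / 2 ^ n) ((⌊2 ^ n * x⌋ : ℝ) / 2 ^ n + 1 / 2 ^ (n + 1)) ∩
        (B \ dyadicRationals)).Nonempty ∧
     (Icc ((⌊2 ^ n * x⌋ : ℝ) / 2 ^ n + 1 / 2 ^ (n + 1)) (((⌊2 ^ n * x⌋ : ℝ) + 1) / 2 ^ n) ∩
        (B \ dyadicRationals)).Nonempty
  then 1 else 0

/-- `OFF B n = inf_{x ∈ B \ D} (1/n) ∑_{i=0}^{n-1} numOff B i x`. -/
noncomputable def OFF (B : Set ℝ) (n : ℕ) : ℝ :=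
  sInf {v : ℝ | ∃ x ∈ B \ dyadicRationals,
    v = (1 / (n : ℝ)) * ∑ i ∈ Finset.range n, numOff B i x}

/-- The half-open `n`-cell with index `k` meets `A`. -/
def CellMeets (A : Set ℝ) (n k : ℕ) : Prop :=
  ∃ x ∈ A, ⌊2 ^ n * x⌋₊ = k

open Classical in
/-- The mass of the half-open `n`-cell with index `k`, where unit mass is split equally among the
halves of each cell that meet `A`. -/
noncomputable def cellMass (A : Set ℝ) : ℕ → ℕ → ℝ
  | 0, k => if CellMeets A 0 k then 1 else 0
  | n + 1, k =>
    if CellMeets A (n + 1) k then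
      (if CellMeets A (n + 1) (2 * (k / 2)) ∧ CellMeets A (n + 1) (2 * (k / 2) + 1)
        then 1 / 2 else 1) * cellMass A n (k / 2)
    else 0

/-- The total mass of the `n`-cells with index less than `k`. -/
noncomputable def cumMass (A : Set ℝ) (n k : ℕ) : ℝ :=
  ∑ j ∈ Finset.range k, cellMass A n j

/-- The cumulative distribution function of the mass distribution `cellMass A`. -/
noncomputable def massCdf (A : Set ℝ) (x : ℝ) : ℝ :=
  ⨆ n : ℕ, cumMass A n ⌊2 ^ n * x⌋₊

lemma floor_two_pow_succ_div (n : ℕ) (x : ℝ) : ⌊2 ^ (n + 1) * x⌋₊ / 2 = ⌊2 ^ n * x⌋₊ := by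
  rw [← Nat.floor_div_ofNat]
  congr 1
  rw [pow_succ]
  ring

lemma cellMeets_iff_children {A : Set ℝ} {n k : ℕ} :
    CellMeets A n k ↔ CellMeets A (n + 1) (2 * k) ∨ CellMeets A (n + 1) (2 * k + 1) := by
  constructor
  · rintro ⟨x, hx, rfl⟩
    have h := floor_two_pow_succ_div n x
    have h2 : ⌊2 ^ (n + 1) * x⌋₊ = 2 * ⌊2 ^ n * x⌋₊ ∨
        ⌊2 ^ (n + 1) * x⌋₊ = 2 * ⌊2 ^ n * x⌋₊ + 1 := by omega
    exact h2.imp (fun h => ⟨x, hx, h⟩) (fun h => ⟨x, hx, h⟩)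
  · rintro (⟨x, hx, h⟩ | ⟨x, hx, h⟩) <;>
    · have h' := floor_two_pow_succ_div n x
      exact ⟨x, hx, by omega⟩

lemma cellMass_nonneg (A : Set ℝ) (n k : ℕ) : 0 ≤ cellMass A n k := by
  induction n generalizing k with
  | zero => unfold cellMass; split_ifs <;> norm_num
  | succ n ih =>
    unfold cellMass
    have := ih (k / 2)
    split_ifs <;> positivity

lemma cellMass_of_not_cellMeets {A : Set ℝ} {n k : ℕ} (h : ¬ CellMeets A n k) :
    cellMass A n k = 0 := by
  cases n <;> simp [cellMass, h]

lemma cellMass_eq_add (A : Set ℝ) (n k : ℕ) :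
    cellMass A n k = cellMass A (n + 1) (2 * k) + cellMass A (n + 1) (2 * k + 1) := by
  have h1 : 2 * k / 2 = k := by omega
  have h2 : (2 * k + 1) / 2 = k := by omega
  have h3 := cellMeets_iff_children (A := A) (n := n) (k := k)
  by_cases h : CellMeets A n k
  · rw [cellMass, cellMass, h1, h2]
    by_cases ha : CellMeets A (n + 1) (2 * k) <;> by_cases hb : CellMeets A (n + 1) (2 * k + 1) <;>
      simp [ha, hb]
    · ring
    · tauto
  · rw [cellMass_of_not_cellMeets h, cellMass_of_not_cellMeets (by tauto),
      cellMass_of_not_cellMeets (by tauto), add_zero]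

lemma cumMass_succ (A : Set ℝ) (n k : ℕ) :
    cumMass A n (k + 1) = cumMass A n k + cellMass A n k :=
  Finset.sum_range_succ _ _

lemma cumMass_mono (A : Set ℝ) (n : ℕ) : Monotone (cumMass A n) :=
  monotone_nat_of_le_succ fun k => by
    rw [cumMass_succ]
    linarith [cellMass_nonneg A n k]

lemma cumMass_double (A : Set ℝ) (n k : ℕ) : cumMass A (n + 1) (2 * k) = cumMass A n k := by
  induction k with
  | zero => simp [cumMass]
  | succ k ih =>
    rw [show 2 * (k + 1) = 2 * k + 1 + 1 by ring, cumMass_succ, cumMass_succ, cumMass_succ, ih,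
      cellMass_eq_add A n k, add_assoc]

lemma cumMass_two_pow_mul (A : Set ℝ) (n p k : ℕ) :
    cumMass A (n + p) (2 ^ p * k) = cumMass A n k := by
  induction p with
  | zero => simp
  | succ p ih => rw [← ih, ← cumMass_double A (n + p), ← add_assoc, pow_succ', mul_assoc]

lemma two_pow_mul_floor_le (n p : ℕ) {x : ℝ} (hx : 0 ≤ x) :
    2 ^ p * ⌊2 ^ n * x⌋₊ ≤ ⌊2 ^ (n + p) * x⌋₊ := by
  apply Nat.le_floor
  have h : (⌊2 ^ n * x⌋₊ : ℝ) ≤ 2 ^ n * x := Nat.floor_le (by positivity)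
  push_cast
  calc (2 : ℝ) ^ p * ⌊2 ^ n * x⌋₊ ≤ 2 ^ p * (2 ^ n * x) := by gcongr
    _ = 2 ^ (n + p) * x := by rw [pow_add]; ring

lemma floor_lt_two_pow_mul (n p : ℕ) {x : ℝ} (hx : 0 ≤ x) :
    ⌊2 ^ (n + p) * x⌋₊ < 2 ^ p * (⌊2 ^ n * x⌋₊ + 1) := by
  rw [Nat.floor_lt (by positivity)]
  have h : 2 ^ n * x < ⌊2 ^ n * x⌋₊ + 1 := Nat.lt_floor_add_one _
  push_cast
  calc (2 : ℝ) ^ (n + p) * x = 2 ^ p * (2 ^ n * x) := by rw [pow_add]; ring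
    _ < 2 ^ p * (⌊2 ^ n * x⌋₊ + 1) := by gcongr

lemma cumMass_floor_le (A : Set ℝ) (n m : ℕ) {x : ℝ} (hx : 0 ≤ x) :
    cumMass A n ⌊2 ^ n * x⌋₊ ≤ cumMass A m (⌊2 ^ m * x⌋₊ + 1) := by
  rw [← cumMass_two_pow_mul A n m, ← cumMass_two_pow_mul A m n, add_comm m n]
  apply cumMass_mono
  have h := floor_lt_two_pow_mul m n hx
  rw [add_comm m n] at h
  exact (two_pow_mul_floor_le n m hx).trans h.le

lemma massCdf_le (A : Set ℝ) (n : ℕ) {x : ℝ} (hx : 0 ≤ x) :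
    massCdf A x ≤ cumMass A n (⌊2 ^ n * x⌋₊ + 1) :=
  ciSup_le fun m => cumMass_floor_le A m n hx

lemma le_massCdf (A : Set ℝ) (n : ℕ) {x : ℝ} (hx : 0 ≤ x) :
    cumMass A n ⌊2 ^ n * x⌋₊ ≤ massCdf A x :=
  le_ciSup (f := fun n => cumMass A n ⌊2 ^ n * x⌋₊)
    ⟨_, forall_mem_range.2 fun m => cumMass_floor_le A m 0 hx⟩ n

lemma massCdf_sub_le {A : Set ℝ} {n : ℕ} {c x y : ℝ} (hc : ∀ k, cellMass A n k ≤ c)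
    (hx : 0 ≤ x) (hxy : x ≤ y) (hyx : y - x ≤ (1 / 2) ^ n) :
    |massCdf A y - massCdf A x| ≤ 2 * c := by
  have hy := hx.trans hxy
  have hfl : ⌊2 ^ n * x⌋₊ ≤ ⌊2 ^ n * y⌋₊ := Nat.floor_mono (by gcongr)
  have hfl' : ⌊2 ^ n * y⌋₊ ≤ ⌊2 ^ n * x⌋₊ + 1 := by
    rw [← Nat.floor_add_one (by positivity)]
    apply Nat.floor_mono
    have : 2 ^ n * (y - x) ≤ 2 ^ n * (1 / 2) ^ n := by gcongr
    rw [← mul_pow] at this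
    norm_num at this
    linarith
  have h1 := massCdf_le A n hx
  have h2 := le_massCdf A n hx
  have h3 := massCdf_le A n hy
  have h4 := le_massCdf A n hy
  have h5 := cumMass_mono A n hfl
  have h6 := cumMass_mono A n (Nat.succ_le_succ hfl')
  simp only [Nat.succ_eq_add_one, cumMass_succ] at h1 h3 h6
  have h7 := hc ⌊2 ^ n * x⌋₊
  have h8 := hc (⌊2 ^ n * x⌋₊ + 1)
  have h9 := cellMass_nonneg A n (⌊2 ^ n * x⌋₊)
  rw [abs_le]
  constructor <;> linarith

lemma holderOnWith_massCdf {A : Set ℝ} {s C : NNReal}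
    (hC : ∀ n k, cellMass A n k ≤ C * ((1 / 2 : ℝ) ^ n) ^ (s : ℝ)) :
    HolderOnWith (2 * C * 2 ^ (s : ℝ)) s (massCdf A) (Ico 0 1) := by
  have key : ∀ x ∈ Ico (0 : ℝ) 1, ∀ y ∈ Ico (0 : ℝ) 1, x < y →
      dist (massCdf A y) (massCdf A x) ≤ (2 * C * 2 ^ (s : ℝ)) * dist y x ^ (s : ℝ) := by
    intro x hx y hy hxy
    obtain ⟨n, hn1, hn2⟩ := exists_nat_pow_near_of_lt_one (x := y - x) (y := 1 / 2)
      (by linarith) (by linarith [hx.1, hy.2]) (by norm_num) (by norm_num)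
    rw [Real.dist_eq, Real.dist_eq, abs_of_pos (sub_pos.2 hxy)]
    refine (massCdf_sub_le (hC n) hx.1 hxy.le hn2).trans ?_
    rw [mul_assoc (2 * (C : ℝ)), ← Real.mul_rpow (by norm_num) (by linarith), mul_assoc]
    gcongr
    rw [pow_succ] at hn1
    linarith
  intro x hx y hy
  have conv : ∀ x y : ℝ,
      dist (massCdf A y) (massCdf A x) ≤ (2 * C * 2 ^ (s : ℝ)) * dist y x ^ (s : ℝ) →
      edist (massCdf A y) (massCdf A x) ≤
        ((2 * C * 2 ^ (s : ℝ) : NNReal) : ℝ≥0∞) * edist y x ^ (s : ℝ) := by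
    intro x y h
    rw [edist_nndist, edist_nndist, ← ENNReal.coe_rpow_of_nonneg _ s.coe_nonneg, ← ENNReal.coe_mul,
      ENNReal.coe_le_coe, ← NNReal.coe_le_coe]
    push_cast
    exact h
  rcases lt_trichotomy x y with h | rfl | h
  · rw [edist_comm, edist_comm x y]
    exact conv x y (key x hx y hy h)
  · simp
  · exact conv y x (key y hy x hx h)

lemma cellMass_zero_zero {A : Set ℝ} (hA : A ⊆ Ico 0 1) (hne : A.Nonempty) :
    cellMass A 0 0 = 1 := by
  obtain ⟨x, hx⟩ := hne
  rw [cellMass, if_pos ⟨x, hx, by simpa using (hA hx).2⟩]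

lemma exists_cellMass_pos {A : Set ℝ} (hA : A ⊆ Ico 0 1) (hne : A.Nonempty) (n : ℕ) {t : ℝ}
    (ht : t ∈ Ico (0 : ℝ) 1) : ∃ k, cumMass A n k ≤ t ∧ t < cumMass A n (k + 1) := by
  have htot : cumMass A n (2 ^ n) = 1 := by
    have h := cumMass_two_pow_mul A 0 n 1
    rw [zero_add, mul_one] at h
    rw [h, cumMass_succ, cellMass_zero_zero hA hne]
    simp [cumMass]
  have hex : ∃ k, t < cumMass A n k := ⟨2 ^ n, by rw [htot]; exact ht.2⟩
  classical
  obtain ⟨k, hk⟩ := Nat.exists_eq_succ_of_ne_zero (n := Nat.find hex) fun h0 => by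
    have := Nat.find_spec hex
    rw [h0] at this
    simp only [cumMass, Finset.range_zero, Finset.sum_empty] at this
    linarith [ht.1]
  refine ⟨k, not_lt.1 (Nat.find_min hex (by omega)), ?_⟩
  have := Nat.find_spec hex
  rwa [hk] at this

lemma exists_abs_massCdf_sub_le {A : Set ℝ} (hA : A ⊆ Ico 0 1) (hne : A.Nonempty) {n : ℕ}
    {c : ℝ} (hc : ∀ k, cellMass A n k ≤ c) {t : ℝ} (ht : t ∈ Ico (0 : ℝ) 1) :
    ∃ x ∈ A, |massCdf A x - t| ≤ c := by
  obtain ⟨k, hk1, hk2⟩ := exists_cellMass_pos hA hne n ht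
  have hm : CellMeets A n k := by
    by_contra h
    rw [cumMass_succ, cellMass_of_not_cellMeets h] at hk2
    linarith
  obtain ⟨x, hx, rfl⟩ := hm
  refine ⟨x, hx, ?_⟩
  have h1 := massCdf_le A n (hA hx).1
  have h2 := le_massCdf A n (hA hx).1
  rw [cumMass_succ] at h1 hk2
  have h3 := hc ⌊2 ^ n * x⌋₊
  rw [abs_le]
  constructor <;> linarith

lemma le_dimH_of_cellMass_le {A B : Set ℝ} (hAB : A ⊆ B) (hne : A.Nonempty)
    (hB : B ⊆ Ico 0 1) (hBc : IsCompact B) {s C : NNReal} (hs : 0 < s)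
    (hC : ∀ n k, cellMass A n k ≤ C * ((1 / 2 : ℝ) ^ n) ^ (s : ℝ)) :
    (s : ℝ≥0∞) ≤ dimH B := by
  have hH := (holderOnWith_massCdf hC).mono hB
  have hcl : IsClosed (massCdf A '' B) := (hBc.image_of_continuousOn (hH.continuousOn hs)).isClosed
  have hlim : Tendsto (fun n : ℕ => (C : ℝ) * ((1 / 2 : ℝ) ^ n) ^ (s : ℝ)) atTop (nhds 0) := by
    have h1 : Tendsto (fun n : ℕ => ((1 / 2 : ℝ) ^ n)) atTop (nhds 0) :=
      tendsto_pow_atTop_nhds_zero_of_lt_one (by norm_num) (by norm_num)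
    have h2 := (h1.rpow_const (p := (s : ℝ)) (Or.inr s.2)).const_mul (C : ℝ)
    rwa [Real.zero_rpow (by exact_mod_cast hs.ne'), mul_zero] at h2
  have hsub : Ico (0 : ℝ) 1 ⊆ massCdf A '' B := by
    intro t ht
    rw [← hcl.closure_eq, Metric.mem_closure_iff]
    intro ε hε
    obtain ⟨n, hn⟩ := (hlim.eventually (gt_mem_nhds hε)).exists
    obtain ⟨x, hx, hxt⟩ := exists_abs_massCdf_sub_le (hAB.trans hB) hne (hC n) ht
    refine ⟨_, mem_image_of_mem _ (hAB hx), ?_⟩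
    rw [dist_comm, Real.dist_eq]
    exact hxt.trans_lt hn
  have hdim : (1 : ℝ≥0∞) ≤ dimH (massCdf A '' B) := by
    refine le_trans (le_of_eq ?_) (dimH_mono hsub)
    rw [Real.dimH_of_nonempty_interior (by simp)]
    simp
  have h := hdim.trans (hH.dimH_image_le hs)
  rwa [ENNReal.le_div_iff_mul_le (by simp [hs.ne']) (by simp), one_mul] at h

lemma mem_left_half_iff {y : ℝ} (hy : 0 ≤ y) (hyD : y ∉ dyadicRationals) (n k : ℕ) :
    y ∈ Icc ((k : ℝ) / 2 ^ n) ((k : ℝ) / 2 ^ n + 1 / 2 ^ (n + 1)) ↔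
      ⌊2 ^ (n + 1) * y⌋₊ = 2 * k := by
  have hne : 2 ^ (n + 1) * y ≠ 2 * k + 1 := fun h =>
    hyD ⟨2 * k + 1, n + 1, by push_cast; field_simp; linarith⟩
  have e1 : (k : ℝ) / 2 ^ n = (2 * k) / 2 ^ (n + 1) := by rw [pow_succ]; field_simp
  rw [Nat.floor_eq_iff (by positivity), mem_Icc, e1, ← add_div, div_le_iff₀' (by positivity),
    le_div_iff₀' (by positivity)]
  push_cast
  exact and_congr_right fun _ => ⟨fun h => lt_of_le_of_ne h hne, le_of_lt⟩

lemma mem_right_half_iff {y : ℝ} (hy : 0 ≤ y) (hyD : y ∉ dyadicRationals) (n k : ℕ) :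
    y ∈ Icc ((k : ℝ) / 2 ^ n + 1 / 2 ^ (n + 1)) (((k : ℝ) + 1) / 2 ^ n) ↔
      ⌊2 ^ (n + 1) * y⌋₊ = 2 * k + 1 := by
  have hne : 2 ^ (n + 1) * y ≠ 2 * k + 1 + 1 := fun h =>
    hyD ⟨2 * k + 1 + 1, n + 1, by push_cast; field_simp; linarith⟩
  have e1 : (k : ℝ) / 2 ^ n = (2 * k) / 2 ^ (n + 1) := by rw [pow_succ]; field_simp
  have e2 : ((k : ℝ) + 1) / 2 ^ n = (2 * k + 1 + 1) / 2 ^ (n + 1) := by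
    rw [pow_succ]; field_simp; ring
  rw [Nat.floor_eq_iff (by positivity), mem_Icc, e1, e2, ← add_div, div_le_iff₀' (by positivity),
    le_div_iff₀' (by positivity)]
  push_cast
  exact and_congr_right fun _ => ⟨fun h => lt_of_le_of_ne h hne, le_of_lt⟩

open Classical in
lemma numOff_eq_ite {B : Set ℝ} (hB : B ⊆ Ico 0 1) (n : ℕ) {x : ℝ} (hx : 0 ≤ x) :
    numOff B n x =
      if CellMeets (B \ dyadicRationals) (n + 1) (2 * ⌊2 ^ n * x⌋₊) ∧
        CellMeets (B \ dyadicRationals) (n + 1) (2 * ⌊2 ^ n * x⌋₊ + 1) then 1 else 0 := by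
  have hfl : (⌊2 ^ n * x⌋ : ℝ) = (⌊2 ^ n * x⌋₊ : ℝ) :=
    (natCast_floor_eq_intCast_floor (by positivity)).symm
  unfold numOff
  rw [hfl]
  congr 2 <;> apply propext
  · refine ⟨fun ⟨y, h, hy⟩ => ⟨y, hy, ?_⟩, fun ⟨y, hy, h⟩ => ⟨y, ?_, hy⟩⟩
    · exact (mem_left_half_iff (hB hy.1).1 hy.2 _ _).1 h
    · exact (mem_left_half_iff (hB hy.1).1 hy.2 _ _).2 h
  · refine ⟨fun ⟨y, h, hy⟩ => ⟨y, hy, ?_⟩, fun ⟨y, hy, h⟩ => ⟨y, ?_, hy⟩⟩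
    · exact (mem_right_half_iff (hB hy.1).1 hy.2 _ _).1 h
    · exact (mem_right_half_iff (hB hy.1).1 hy.2 _ _).2 h

lemma cellMass_floor {B : Set ℝ} (hB : B ⊆ Ico 0 1) (n : ℕ) {x : ℝ}
    (hx : x ∈ B \ dyadicRationals) :
    cellMass (B \ dyadicRationals) n ⌊2 ^ n * x⌋₊ =
      (1 / 2 : ℝ) ^ (∑ i ∈ Finset.range n, numOff B i x) := by
  induction n with
  | zero =>
    rw [cellMass, if_pos ⟨x, hx, rfl⟩]
    simp
  | succ n ih =>
    rw [cellMass, if_pos ⟨x, hx, rfl⟩, floor_two_pow_succ_div, ih, Finset.sum_range_succ,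
      numOff_eq_ite hB n (hB hx.1).1, Real.rpow_add (by norm_num), mul_comm]
    split_ifs <;> simp

lemma numOff_nonneg (B : Set ℝ) (n : ℕ) (x : ℝ) : 0 ≤ numOff B n x := by
  unfold numOff
  split_ifs <;> norm_num

lemma OFF_nonneg (B : Set ℝ) (n : ℕ) : 0 ≤ OFF B n := by
  apply Real.sInf_nonneg
  rintro _ ⟨x, -, rfl⟩
  have := Finset.sum_nonneg fun i (_ : i ∈ Finset.range n) => numOff_nonneg B i x
  positivity

lemma OFF_le {B : Set ℝ} (n : ℕ) {x : ℝ} (hx : x ∈ B \ dyadicRationals) :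
    OFF B n ≤ (1 / (n : ℝ)) * ∑ i ∈ Finset.range n, numOff B i x := by
  refine csInf_le ⟨0, ?_⟩ ⟨x, hx, rfl⟩
  rintro _ ⟨x, -, rfl⟩
  have := Finset.sum_nonneg fun i (_ : i ∈ Finset.range n) => numOff_nonneg B i x
  positivity

lemma cellMass_le_of_le_OFF {B : Set ℝ} (hB : B ⊆ Ico 0 1) {n : ℕ} {s : ℝ} (hs : s ≤ OFF B n)
    (k : ℕ) : cellMass (B \ dyadicRationals) n k ≤ ((1 / 2 : ℝ) ^ n) ^ s := by
  by_cases h : CellMeets (B \ dyadicRationals) n k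
  · obtain ⟨x, hx, rfl⟩ := h
    rw [cellMass_floor hB n hx, ← Real.rpow_natCast, ← Real.rpow_mul (by norm_num)]
    apply Real.rpow_le_rpow_of_exponent_ge (by norm_num) (by norm_num)
    rcases Nat.eq_zero_or_pos n with rfl | hn
    · simp
    · have h := hs.trans (OFF_le n hx)
      rwa [one_div, ← div_eq_inv_mul, le_div_iff₀' (by exact_mod_cast hn)] at h
  · rw [cellMass_of_not_cellMeets h]
    positivity

lemma cellMass_le_one {B : Set ℝ} (hB : B ⊆ Ico 0 1) (n k : ℕ) :
    cellMass (B \ dyadicRationals) n k ≤ 1 := by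
  simpa using cellMass_le_of_le_OFF hB (OFF_nonneg B n) k

theorem liminf_OFF_le_dimH
    (B : Set ℝ) (hBsub : B ⊆ Ico (0 : ℝ) 1) (hBc : IsCompact B)
    (hne : (B \ dyadicRationals).Nonempty) :
    ENNReal.ofReal (liminf (fun n : ℕ => OFF B n) atTop) ≤ dimH B := by
  refine le_of_forall_lt fun c hc => ?_
  obtain ⟨s, hcs, hs⟩ := ENNReal.lt_iff_exists_nnreal_btwn.1 hc
  refine hcs.trans_le ?_
  have hs0 : 0 < s := ENNReal.coe_pos.1 (bot_le.trans_lt hcs)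
  have hs' : (s : ℝ) < liminf (fun n : ℕ => OFF B n) atTop := by
    rwa [← ENNReal.ofReal_coe_nnreal, ENNReal.ofReal_lt_ofReal_iff_of_nonneg s.coe_nonneg] at hs
  have hev := eventually_lt_of_lt_liminf hs' (isBoundedUnder_of ⟨0, OFF_nonneg B⟩)
  obtain ⟨N, hN⟩ := eventually_atTop.1 hev
  refine le_dimH_of_cellMass_le (C := ((2 : NNReal) ^ N) ^ (s : ℝ)) sdiff_subset hne hBsub hBc hs0
    fun n k => ?_
  push_cast
  rw [← Real.mul_rpow (by positivity) (by positivity)]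
  rcases le_total N n with hn | hn
  · refine (cellMass_le_of_le_OFF hBsub (hN n hn).le k).trans ?_
    gcongr
    exact le_mul_of_one_le_left (by positivity) (one_le_pow₀ (by norm_num))
  · refine (cellMass_le_one hBsub n k).trans (Real.one_le_rpow ?_ s.2)
    calc (1 : ℝ) = 2 ^ n * (1 / 2) ^ n := by rw [← mul_pow]; norm_num
      _ ≤ 2 ^ N * (1 / 2) ^ n := by gcongr; norm_num
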